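/- For every positive integer n, L_n^EVEN − L_n^ODD = (−1)^{n(n−1)/2} Σ_{A∈B_n} (−1)^{σ0(A)} det(A)^n, where the sum is over all n×n (0,1)-matrices A (determinants computed over ℤ). -/

import Mathlib

/-- `L` is a Latin square of order `n`: every row and every column is a
bijection of `Fin n` (i.e. contains each symbol exactly once). -/
def IsLatin {n : ℕ} (L : Fin n → Fin n → Fin n) : Prop :=
  (∀ i, Function.Bijective fun j => L i j) ∧ ∀ j, Function.Bijective fun i => L i j

/-- The permutation determined by a bijective function (junk value `1` otherwise). -/
noncomputable def permOf {n : ℕ} (f : Fin n → Fin n) : Equiv.Perm (Fin n) :=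
  if h : Function.Bijective f then Equiv.ofBijective f h else 1

/-- The product of the signs of the rows of `L`. -/
noncomputable def rowSign {n : ℕ} (L : Fin n → Fin n → Fin n) : ℤ :=
  ∏ i, (Equiv.Perm.sign (permOf fun j => L i j) : ℤ)

/-- The product of the signs of the columns of `L`. -/
noncomputable def colSign {n : ℕ} (L : Fin n → Fin n → Fin n) : ℤ :=
  ∏ j, (Equiv.Perm.sign (permOf fun i => L i j) : ℤ)

/-- The sign of a Latin square: row-sign times column-sign. -/
noncomputable def latinSign {n : ℕ} (L : Fin n → Fin n → Fin n) : ℤ :=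
  rowSign L * colSign L

/-- The permutation `α_s` of a Latin square `L`: `α_s i = j` iff `L i j = s`. -/
noncomputable def symPerm {n : ℕ} (L : Fin n → Fin n → Fin n) (s : Fin n) :
    Equiv.Perm (Fin n) :=
  permOf fun i => (permOf fun j => L i j).symm s

/-- The symbol-sign of a Latin square: the product of the signs of the `α_s`. -/
noncomputable def symbolSign {n : ℕ} (L : Fin n → Fin n → Fin n) : ℤ :=
  ∏ s, (Equiv.Perm.sign (symPerm L s) : ℤ)

/-- The number of Latin squares of order `n`. -/
noncomputable def numLatin (n : ℕ) : ℕ :=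
  Nat.card {L : Fin n → Fin n → Fin n // IsLatin L}

/-- The number of even Latin squares of order `n`. -/
noncomputable def numLatinEven (n : ℕ) : ℕ :=
  Nat.card {L : Fin n → Fin n → Fin n // IsLatin L ∧ latinSign L = 1}

/-- The number of odd Latin squares of order `n`. -/
noncomputable def numLatinOdd (n : ℕ) : ℕ :=
  Nat.card {L : Fin n → Fin n → Fin n // IsLatin L ∧ latinSign L = -1}

/-- `L` is normalized: its first row is the identity permutation. -/
def IsNormalized {n : ℕ} (L : Fin n → Fin n → Fin n) : Prop :=
  ∀ j : Fin n, L ⟨0, j.pos⟩ j = j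

/-- `L` is unipotent: all entries on the main diagonal are equal. -/
def IsUnipotent {n : ℕ} (L : Fin n → Fin n → Fin n) : Prop :=
  ∀ i k : Fin n, L i i = L k k

/-- The Alon-Tarsi constant `AT(n) = U_n^E - U_n^O`. -/
noncomputable def AT (n : ℕ) : ℤ :=
  (Nat.card {L : Fin n → Fin n → Fin n //
      IsLatin L ∧ IsNormalized L ∧ IsUnipotent L ∧ latinSign L = 1} : ℤ) -
  (Nat.card {L : Fin n → Fin n → Fin n //
      IsLatin L ∧ IsNormalized L ∧ IsUnipotent L ∧ latinSign L = -1} : ℤ)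

/-- `L` is reduced: first row and first column are the identity. -/
def IsReducedLatin {n : ℕ} (L : Fin n → Fin n → Fin n) : Prop :=
  IsNormalized L ∧ ∀ i : Fin n, L i ⟨0, i.pos⟩ = i

/-- The number of even reduced Latin squares of order `n`. -/
noncomputable def numReducedEven (n : ℕ) : ℕ :=
  Nat.card {L : Fin n → Fin n → Fin n // IsLatin L ∧ IsReducedLatin L ∧ latinSign L = 1}

/-- The number of odd reduced Latin squares of order `n`. -/
noncomputable def numReducedOdd (n : ℕ) : ℕ :=
  Nat.card {L : Fin n → Fin n → Fin n // IsLatin L ∧ IsReducedLatin L ∧ latinSign L = -1}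

/-- `L_n^SE(π)`: Latin squares whose permutation `α₁` (of the first symbol)
is `π` and whose symbol-sign is `+1`. The first symbol is the element of
`Fin n` with value `0`, and `α₁ = π` is expressed by `L i (π i) = first symbol`. -/
noncomputable def numSymEven (n : ℕ) (π : Equiv.Perm (Fin n)) : ℕ :=
  Nat.card {L : Fin n → Fin n → Fin n //
    IsLatin L ∧ (∀ i, (L i (π i)).val = 0) ∧ symbolSign L = 1}

/-- `L_n^SO(π)`: as `numSymEven` but with symbol-sign `-1`. -/
noncomputable def numSymOdd (n : ℕ) (π : Equiv.Perm (Fin n)) : ℕ :=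
  Nat.card {L : Fin n → Fin n → Fin n //
    IsLatin L ∧ (∀ i, (L i (π i)).val = 0) ∧ symbolSign L = -1}

/-- `L_n^CE(π)`: column-even Latin squares with first column `π`. -/
noncomputable def numColEven (n : ℕ) (π : Equiv.Perm (Fin n)) : ℕ :=
  Nat.card {L : Fin n → Fin n → Fin n //
    IsLatin L ∧ (∀ i : Fin n, L i ⟨0, i.pos⟩ = π i) ∧ colSign L = 1}

/-- `L_n^CO(π)`: column-odd Latin squares with first column `π`. -/
noncomputable def numColOdd (n : ℕ) (π : Equiv.Perm (Fin n)) : ℕ :=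
  Nat.card {L : Fin n → Fin n → Fin n //
    IsLatin L ∧ (∀ i : Fin n, L i ⟨0, i.pos⟩ = π i) ∧ colSign L = -1}

/-- `L_n^CE(α, β)`: column-even Latin squares with first row `α` and first column `β`. -/
noncomputable def numColEven₂ (n : ℕ) (α β : Equiv.Perm (Fin n)) : ℕ :=
  Nat.card {L : Fin n → Fin n → Fin n //
    IsLatin L ∧ (∀ j : Fin n, L ⟨0, j.pos⟩ j = α j) ∧
      (∀ i : Fin n, L i ⟨0, i.pos⟩ = β i) ∧ colSign L = 1}

/-- `L_n^CO(α, β)`: column-odd Latin squares with first row `α` and first column `β`. -/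
noncomputable def numColOdd₂ (n : ℕ) (α β : Equiv.Perm (Fin n)) : ℕ :=
  Nat.card {L : Fin n → Fin n → Fin n //
    IsLatin L ∧ (∀ j : Fin n, L ⟨0, j.pos⟩ j = α j) ∧
      (∀ i : Fin n, L i ⟨0, i.pos⟩ = β i) ∧ colSign L = -1}

/-- The `n × n` matrix of indeterminates, over `ℤ`. -/
noncomputable def Xmat (n : ℕ) :
    Matrix (Fin n) (Fin n) (MvPolynomial (Fin n × Fin n) ℤ) :=
  Matrix.of fun i j => MvPolynomial.X (i, j)

/-- The exponent vector of the square-free monomial `∏_{i,j} X i j`. -/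
noncomputable def allOnes (n : ℕ) : (Fin n × Fin n) →₀ ℕ :=
  Finsupp.equivFunOnFinite.symm fun _ => 1

/-- The `(0,1)`-matrix (over `ℤ`) associated to a Boolean matrix. -/
def toInt {n : ℕ} (A : Fin n → Fin n → Bool) : Matrix (Fin n) (Fin n) ℤ :=
  Matrix.of fun i j => if A i j then 1 else 0

/-- `σ₀(A)`: the number of zero entries of a `(0,1)`-matrix. -/
def sigma0 {n : ℕ} (A : Fin n → Fin n → Bool) : ℕ :=
  (Finset.univ.filter fun p : Fin n × Fin n => A p.1 p.2 = false).card

theorem permOf_apply {n : ℕ} {f : Fin n → Fin n} (h : Function.Bijective f) (x : Fin n) :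
    permOf f x = f x := by
  rw [permOf, dif_pos h, Equiv.ofBijective_apply]

theorem IsLatin.apply_permOf_symm {n : ℕ} {L : Fin n → Fin n → Fin n} (hL : IsLatin L)
    (s i : Fin n) : L i ((permOf fun j => L i j).symm s) = s := by
  rw [← permOf_apply (hL.1 i), Equiv.apply_symm_apply]

theorem IsLatin.symPerm_apply {n : ℕ} {L : Fin n → Fin n → Fin n} (hL : IsLatin L)
    (s i : Fin n) : symPerm L s i = (permOf fun j => L i j).symm s := by
  refine permOf_apply (Finite.injective_iff_bijective.1 fun i k hik => ?_) i
  have hi := hL.apply_permOf_symm s i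
  have hk := hL.apply_permOf_symm s k
  rw [← hik] at hk
  exact (hL.2 _).1 (hi.trans hk.symm)

theorem IsLatin.apply_symPerm {n : ℕ} {L : Fin n → Fin n → Fin n} (hL : IsLatin L)
    (s i : Fin n) : L i (symPerm L s i) = s := by
  rw [hL.symPerm_apply, hL.apply_permOf_symm]

theorem IsLatin.symPerm_apply_self {n : ℕ} {L : Fin n → Fin n → Fin n} (hL : IsLatin L)
    (i j : Fin n) : symPerm L (L i j) i = j :=
  (hL.1 i).1 (hL.apply_symPerm _ _)

theorem sign_prodComm_fin (n : ℕ) :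
    Equiv.Perm.sign (Equiv.prodComm (Fin n) (Fin n)) = (-1) ^ (n * (n - 1) / 2) := by
  have hfix : Fintype.card (Function.fixedPoints (Equiv.prodComm (Fin n) (Fin n))) = n := by
    refine (Fintype.card_congr
      (⟨fun p => p.1.1, fun i => ⟨(i, i), rfl⟩, ?_, fun _ => rfl⟩ : _ ≃ Fin n)).trans
      (Fintype.card_fin n)
    rintro ⟨⟨i, j⟩, h⟩
    have hij : j = i := congrArg Prod.fst h
    subst hij
    rfl
  have hsq : (Equiv.prodComm (Fin n) (Fin n) : Equiv.Perm (Fin n × Fin n)) ^ 2 = 1 := by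
    ext x <;> simp [sq]
  rw [Equiv.Perm.sign_of_pow_two_eq_one hsq, hfix, Fintype.card_prod, Fintype.card_fin,
    Nat.mul_sub_one]

/-- The row, column and symbol signs of a Latin square determine each other. -/
theorem IsLatin.latinSign_eq {n : ℕ} {L : Fin n → Fin n → Fin n} (hL : IsLatin L) :
    latinSign L = (-1) ^ (n * (n - 1) / 2) * symbolSign L := by
  have key : Equiv.prodCongrLeft (fun j => permOf fun i => L i j) =
      (Equiv.prodCongrRight (symPerm L) * Equiv.prodComm (Fin n) (Fin n) *
        Equiv.prodCongrRight (fun i => permOf fun j => L i j) :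
          Equiv.Perm (Fin n × Fin n)) := by
    refine Equiv.ext fun ⟨i, j⟩ => ?_
    simp [permOf_apply (hL.1 i), permOf_apply (hL.2 j), hL.symPerm_apply_self]
  have hsign := congrArg Equiv.Perm.sign key
  rw [Equiv.Perm.sign_mul, Equiv.Perm.sign_mul, Equiv.Perm.sign_prodCongrLeft,
    Equiv.Perm.sign_prodCongrRight, Equiv.Perm.sign_prodCongrRight, sign_prodComm_fin] at hsign
  have hunits : (∏ i, Equiv.Perm.sign (permOf fun j => L i j)) *
      (∏ j, Equiv.Perm.sign (permOf fun i => L i j)) =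
      (-1) ^ (n * (n - 1) / 2) * ∏ s, Equiv.Perm.sign (symPerm L s) := by
    rw [hsign, mul_comm, mul_assoc, Int.units_mul_self, mul_one, mul_comm]
  simpa [latinSign, rowSign, colSign, symbolSign] using congrArg (Units.val : ℤˣ → ℤ) hunits

theorem latinSign_eq_one_or {n : ℕ} (L : Fin n → Fin n → Fin n) :
    latinSign L = 1 ∨ latinSign L = -1 := by
  have h := Int.units_eq_one_or ((∏ i, Equiv.Perm.sign (permOf fun j => L i j)) *
    ∏ j, Equiv.Perm.sign (permOf fun i => L i j))
  simpa [latinSign, rowSign, colSign, Units.ext_iff] using h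

open scoped Classical in
theorem numLatinEven_sub_numLatinOdd (n : ℕ) :
    (numLatinEven n : ℤ) - numLatinOdd n =
      ∑ L : Fin n → Fin n → Fin n with IsLatin L, latinSign L := by
  rw [numLatinEven, numLatinOdd, Nat.card_eq_fintype_card, Nat.card_eq_fintype_card,
    Fintype.card_subtype, Fintype.card_subtype, ← Finset.filter_filter, ← Finset.filter_filter,
    Finset.card_filter, Finset.card_filter]
  push_cast
  rw [← Finset.sum_sub_distrib]
  refine Finset.sum_congr rfl fun L _ => ?_
  rcases latinSign_eq_one_or L with h | h <;> simp [h]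

open scoped Classical in
/-- Latin squares correspond to families of permutations whose graphs cover all cells. -/
theorem sum_symbolSign_eq (n : ℕ) :
    ∑ L : Fin n → Fin n → Fin n with IsLatin L, symbolSign L =
      ∑ P : Fin n → Equiv.Perm (Fin n) with ∀ i j, ∃ s, P s i = j,
        ∏ s, (Equiv.Perm.sign (P s) : ℤ) := by
  refine Finset.sum_bij (fun L _ => symPerm L) ?_ ?_ ?_ fun _ _ => rfl
  · intro L hL
    rw [Finset.mem_filter_univ] at hL ⊢
    exact fun i j => ⟨L i j, hL.symPerm_apply_self i j⟩
  · intro L hL M hM h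
    rw [Finset.mem_filter_univ] at hL hM
    funext i j
    rw [← hL.symPerm_apply_self i j, h, hM.apply_symPerm, ← h, hL.symPerm_apply_self]
  · intro P hP
    rw [Finset.mem_filter_univ] at hP
    choose L hLP using hP
    have hPinj (i : Fin n) : Function.Injective fun s => P s i :=
      Finite.injective_iff_surjective.2 fun j => ⟨L i j, hLP i j⟩
    have hPL (i s : Fin n) : L i (P s i) = s := hPinj i (hLP i _)
    have hL : IsLatin L :=
      ⟨fun i => Finite.surjective_iff_bijective.1 fun s => ⟨P s i, hPL i s⟩,
        fun j => Finite.surjective_iff_bijective.1 fun s =>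
          ⟨(P s).symm j, by simpa using hPL ((P s).symm j) s⟩⟩
    refine ⟨L, (Finset.mem_filter_univ _).2 hL, ?_⟩
    funext s
    refine Equiv.ext fun i => (hL.1 i).1 ?_
    simp only [hL.apply_symPerm, hPL]

theorem neg_one_pow_sigma0 {n : ℕ} (A : Fin n → Fin n → Bool) :
    (-1 : ℤ) ^ sigma0 A = ∏ i, ∏ j, if A i j then 1 else -1 := by
  rw [← Fintype.prod_prod_type', sigma0, ← Finset.prod_const, Finset.prod_filter]
  refine Finset.prod_congr rfl fun p _ => ?_
  cases A p.1 p.2 <;> simp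

theorem prod_prod_boole {ι κ : Type*} [Fintype ι] [Fintype κ] (C : ι → κ → Prop)
    [∀ i j, Decidable (C i j)] [Decidable (∀ i j, C i j)] :
    ∏ i, ∏ j, (if C i j then 1 else 0 : ℤ) = if ∀ i j, C i j then 1 else 0 := by
  classical
  simp_rw [Fintype.prod_boole]
  congr

/-- Inclusion–exclusion over the Boolean matrices that are true on a set `C` of cells. -/
theorem sum_neg_one_pow_sigma0_of_cover {n : ℕ} (C : Fin n → Fin n → Prop)
    [∀ i j, Decidable (C i j)] :
    ∑ A : Fin n → Fin n → Bool,
      (-1 : ℤ) ^ sigma0 A * (if ∀ i j, C i j → A i j = true then 1 else 0) =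
      if ∀ i j, C i j then 1 else 0 := by
  have hterm (A : Fin n → Fin n → Bool) :
      (-1 : ℤ) ^ sigma0 A * (if ∀ i j, C i j → A i j = true then 1 else 0) =
        ∏ i, ∏ j, (if A i j then 1 else -1) * if C i j → A i j = true then 1 else 0 := by
    simp only [neg_one_pow_sigma0, Finset.prod_mul_distrib, prod_prod_boole]
  have hcell (i j : Fin n) :
      ∑ b : Bool, ((if b then 1 else -1) * if C i j → b = true then 1 else 0 : ℤ) =
        if C i j then 1 else 0 := by
    by_cases h : C i j <;> simp [h]
  simp_rw [hterm]
  rw [← Fintype.piFinset_univ, ← Finset.prod_univ_sum (fun _ => Finset.univ)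
    (fun i (a : Fin n → Bool) =>
      ∏ j, ((if a j then 1 else -1) * if C i j → a j = true then 1 else 0 : ℤ))]
  have hrow (i : Fin n) :
      ∑ a : Fin n → Bool, ∏ j, ((if a j then 1 else -1) *
        if C i j → a j = true then 1 else 0 : ℤ) = if ∀ j, C i j then 1 else 0 := by
    rw [← Fintype.piFinset_univ, ← Finset.prod_univ_sum (fun _ => Finset.univ)
      (fun j b => ((if b then 1 else -1) * if C i j → b = true then 1 else 0 : ℤ))]
    simp only [hcell, Fintype.prod_boole]
    congr
  simp only [hrow, Fintype.prod_boole]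
  congr

theorem det_toInt_pow {n : ℕ} (A : Fin n → Fin n → Bool) :
    (toInt A).det ^ n = ∑ P : Fin n → Equiv.Perm (Fin n),
      (∏ s, (Equiv.Perm.sign (P s) : ℤ)) *
        if ∀ i j, (∃ s, P s i = j) → A i j = true then 1 else 0 := by
  rw [← Matrix.det_transpose, Matrix.det_apply', Fintype.sum_pow]
  refine Finset.sum_congr rfl fun P _ => ?_
  simp only [Finset.prod_mul_distrib, Matrix.transpose_apply, toInt, Matrix.of_apply]
  rw [prod_prod_boole fun s i => A i (P s i) = true]
  congr 1
  have hiff : (∀ s i, A i (P s i) = true) ↔ ∀ i j, (∃ s, P s i = j) → A i j = true :=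
    ⟨fun h i _ ⟨s, hs⟩ => hs ▸ h s i, fun h s i => h i _ ⟨s, rfl⟩⟩
  exact if_congr hiff rfl rfl

/-- **Stones.** `L_n^EVEN - L_n^ODD = (-1)^{n(n-1)/2} ∑_{A ∈ B_n} (-1)^{σ₀(A)} det(A)^n`. -/
theorem latin_diff_eq_signed_det_sum (n : ℕ) (hn : 0 < n) :
    (numLatinEven n : ℤ) - numLatinOdd n
      = (-1) ^ (n * (n - 1) / 2) *
          ∑ A : Fin n → Fin n → Bool, (-1 : ℤ) ^ sigma0 A * (toInt A).det ^ n := by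
  classical
  have hsum : ∑ A : Fin n → Fin n → Bool, (-1 : ℤ) ^ sigma0 A * (toInt A).det ^ n =
      ∑ P : Fin n → Equiv.Perm (Fin n) with ∀ i j, ∃ s, P s i = j,
        ∏ s, (Equiv.Perm.sign (P s) : ℤ) := by
    simp_rw [det_toInt_pow, Finset.mul_sum]
    rw [Finset.sum_comm, Finset.sum_filter]
    refine Finset.sum_congr rfl fun P _ => ?_
    simp_rw [mul_left_comm _ (∏ s, (Equiv.Perm.sign (P s) : ℤ))]
    have h := sum_neg_one_pow_sigma0_of_cover fun i j => ∃ s, P s i = j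
    rw [← Finset.mul_sum, h, mul_ite, mul_one, mul_zero]
  rw [hsum, ← sum_symbolSign_eq, numLatinEven_sub_numLatinOdd, Finset.mul_sum]
  exact Finset.sum_congr rfl fun L hL => ((Finset.mem_filter_univ _).1 hL).latinSign_eq
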